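/- Let W be a suitable basis of A at {β₁,…,β_I}, and let e_w ∈ C[x] and M_w ∈ C[x]^{r×r} be such that SW = (1/e_w)·M_wW and the gcd of e_w together with all entries of M_w equals 1. Then e_w is shift-free, every root of e_w in C̄ lies in {β₁,…,β_I}, and M_w is an invertible matrix over C(x). -/

import Mathlib

set_option maxHeartbeats 1000000
set_option synthInstance.maxHeartbeats 200000

open Polynomial Filter

noncomputable section

namespace PRec

variable (C : Type*) [Field C] [CharZero C]

/-- The algebraic closure of the coefficient field. -/
abbrev Cbar := AlgebraicClosure C

/-- The field of formal Laurent series over the algebraic closure. -/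
abbrev LS := LaurentSeries (Cbar C)

/-- The Laurent-series variable `q`. -/
def qv : LS C := HahnSeries.single 1 1

open Classical in
/-- The valuation `ν_q`, with `ν_q 0 = ⊤`, valued in the extended reals. -/
def nuq (a : LS C) : EReal := if a = 0 then ⊤ else (((a.order : ℤ) : ℝ) : EReal)

/-- Evaluation of a rational function at the point `α + m + q`. -/
def evalAt (α : Cbar C) (m : ℤ) (p : RatFunc C) : LS C :=
  RatFunc.eval ((algebraMap (Cbar C) (LS C)).comp (algebraMap C (Cbar C)))
    (algebraMap (Cbar C) (LS C) α + (m : LS C) + qv C) p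

/-- Shorthand for the canonical map `C[x] → C(x)`. -/
abbrev toRat : Polynomial C →+* RatFunc C := algebraMap (Polynomial C) (RatFunc C)

variable (ℓ : ℕ → Polynomial C) (r : ℕ)

/-- The solution space `Sol_α(L)` of `L = ℓ₀ + ℓ₁ S + ⋯ + ℓ_r S^r` at `α`,
indexed so that `b n` stands for the value of the solution at `α + n`. -/
def SolSet (α : Cbar C) : Set (ℤ → LS C) :=
  {b | ∀ n : ℤ, ∑ i ∈ Finset.range (r + 1),
      evalAt C α n (toRat C (ℓ i)) * b (n + i) = 0}

/-- The action of an element `f = f₀ + f₁ S + ⋯ + f_{r-1} S^{r-1}` of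
`A = C(x)[S]/⟨L⟩` (represented by its coefficient vector) on a sequence. -/
def elemApply (α : Cbar C) (f : Fin r → RatFunc C) (b : ℤ → LS C) : ℤ → LS C :=
  fun n => ∑ i : Fin r, evalAt C α n (f i) * b (n + (i : ℤ))

/-- Truncated subtraction on extended reals with the convention `⊤ - ⊤ = ⊤`. -/
def esub (a b : EReal) : EReal := if b = ⊤ then ⊤ else a - b

/-- The value function `val_α` on `A`. -/
def valAt (α : Cbar C) (f : Fin r → RatFunc C) : EReal :=
  ⨅ b ∈ SolSet C ℓ r α,
    esub (nuq C (elemApply C r α f b 0))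
      (Filter.liminf (fun n : ℕ => nuq C (b (-(n : ℤ)))) Filter.atTop)

/-- `f ∈ A` is (locally) integral at `α`. -/
def IntegralAt (α : Cbar C) (f : Fin r → RatFunc C) : Prop :=
  0 ≤ valAt C ℓ r α f

/-- Membership in the local subring `C(x)_α` of rational functions having no pole at `α`. -/
def InLocalRing (α : Cbar C) (f : RatFunc C) : Prop :=
  ∃ p q : Polynomial C, (Polynomial.aeval α) q ≠ 0 ∧ f = toRat C p / toRat C q

/-- `W` is a `C(x)`-vector space basis of `A` (represented on coefficient vectors). -/
def IsVSBasis (W : Fin r → (Fin r → RatFunc C)) : Prop :=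
  LinearIndependent (RatFunc C) W ∧
    Submodule.span (RatFunc C) (Set.range W) = (⊤ : Submodule (RatFunc C) (Fin r → RatFunc C))

/-- The `C(x)_α`-span of a tuple of elements of `A`. -/
def localSpan (α : Cbar C) (W : Fin r → (Fin r → RatFunc C)) :
    Set (Fin r → RatFunc C) :=
  {f | ∃ c : Fin r → RatFunc C, (∀ i, InLocalRing C α (c i)) ∧ f = ∑ i, c i • W i}

/-- `W` is a local integral basis of `A` at `α`. -/
def IsLocalIntegralBasis (α : Cbar C) (W : Fin r → (Fin r → RatFunc C)) : Prop :=
  IsVSBasis C r W ∧ (∀ i, IntegralAt C ℓ r α (W i)) ∧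
    ∀ f : Fin r → RatFunc C, IntegralAt C ℓ r α f → f ∈ localSpan C r α W

/-- The standard basis `1, S, …, S^{r-1}` of `A`. -/
def stdBasis : Fin r → (Fin r → RatFunc C) :=
  fun i j => if j = i then 1 else 0

/-- The shift automorphism `p(x) ↦ p(x+c)` of the polynomial ring. -/
def polyShiftEquiv (c : C) : Polynomial C ≃+* Polynomial C where
  toFun p := p.comp (X + Polynomial.C c)
  invFun p := p.comp (X - Polynomial.C c)
  left_inv p := by
    show (p.comp (X + Polynomial.C c)).comp (X - Polynomial.C c) = p
    rw [Polynomial.comp_assoc]; simp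
  right_inv p := by
    show (p.comp (X - Polynomial.C c)).comp (X + Polynomial.C c) = p
    rw [Polynomial.comp_assoc]; simp
  map_add' p q := by simp [Polynomial.add_comp]
  map_mul' p q := by simp [Polynomial.mul_comp]

/-- The shift `σ^k`, `p(x) ↦ p(x+k)`, on polynomials, for `k : ℤ`. -/
def polyShift (k : ℤ) (p : Polynomial C) : Polynomial C := polyShiftEquiv C (k : C) p

/-- `σ` on polynomials. -/
def polyσ : Polynomial C ≃+* Polynomial C := polyShiftEquiv C 1

/-- The shift automorphism `σ : f(x) ↦ f(x+1)` of the rational function field. -/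
def ratσ : RatFunc C →+* RatFunc C :=
  RatFunc.mapRingHom (polyσ C : Polynomial C →+* Polynomial C)
    (by
      intro p hp
      simp only [Submonoid.mem_comap]
      refine mem_nonZeroDivisors_iff_ne_zero.mpr ?_
      have hp0 : p ≠ 0 := mem_nonZeroDivisors_iff_ne_zero.mp hp
      simpa using (map_ne_zero_iff _ (polyσ C).injective).mpr hp0)

variable [NeZero r]

/-- The index `r - 1` as an element of `Fin r`. -/
def lastIdx : Fin r := ⟨r - 1, Nat.sub_lt (Nat.pos_of_ne_zero (NeZero.ne r)) one_pos⟩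

/-- The action of `S` on `A = C(x)[S]/⟨L⟩`, on coefficient vectors with respect to the
basis `1, S, …, S^{r-1}`, using `S^r = -(ℓ₀/ℓ_r) - ⋯ - (ℓ_{r-1}/ℓ_r) S^{r-1}`. -/
def Smap (f : Fin r → RatFunc C) : Fin r → RatFunc C :=
  fun j =>
    (if (j : ℕ) = 0 then 0 else
      ratσ C (f ⟨(j : ℕ) - 1, lt_of_le_of_lt (Nat.sub_le _ _) j.isLt⟩))
      - ratσ C (f (lastIdx r)) * (toRat C (ℓ j) / toRat C (ℓ r))

/-- The difference operator `Δ = S - 1` on `A`. -/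
def Dmap (f : Fin r → RatFunc C) : Fin r → RatFunc C :=
  Smap C ℓ r f - f

/-- `f ∈ A` is summable. -/
def IsSummable (f : Fin r → RatFunc C) : Prop :=
  ∃ g : Fin r → RatFunc C, f = Dmap C ℓ r g

/-- `disp_α(p) ≥ k`: `p` has two roots in `α + ℤ` at distance `k`. -/
def DispGe (α : Cbar C) (p : Polynomial (Cbar C)) (k : ℕ) : Prop :=
  ∃ m : ℤ, Polynomial.eval (α + (m : Cbar C)) p = 0 ∧
    Polynomial.eval (α + (m : Cbar C) + (k : Cbar C)) p = 0

/-- The dispersion `disp_α(p)` as an extended natural number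
(`0` by convention for the empty set, which is excluded by the hypotheses below). -/
def dispVal (α : Cbar C) (p : Polynomial (Cbar C)) : ℕ∞ :=
  sSup ((fun k : ℕ => (k : ℕ∞)) '' {k : ℕ | DispGe C α p k})

/-- A polynomial is shift-free if it is coprime to each of its nontrivial shifts. -/
def ShiftFree {K : Type*} [Field K] [CharZero K] (p : Polynomial K) : Prop :=
  ∀ k : ℤ, k ≠ 0 → IsCoprime p (p.comp (X + Polynomial.C (k : K)))


/-- The data of the orbits `α_i + ℤ` of the roots of `ℓ₀ℓ_r`, with the minimal root
`minR i = α_{i,1}`, the maximal root `maxR i = α_{i,J_i}`, and the chosen bounds `β i`. -/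
structure SuitableData (I : ℕ) where
  β : Fin I → Cbar C
  minR : Fin I → Cbar C
  maxR : Fin I → Cbar C
  minR_root : ∀ i, (Polynomial.aeval (minR i)) (ℓ 0 * ℓ r) = 0
  maxR_root : ∀ i, (Polynomial.aeval (maxR i)) (ℓ 0 * ℓ r) = 0
  minR_le_maxR : ∀ i, ∃ m : ℕ, maxR i = minR i + (m : Cbar C)
  maxR_le_β : ∀ i, ∃ m : ℕ, β i = maxR i + (m : Cbar C)
  roots_between : ∀ i (m : ℤ), (Polynomial.aeval (minR i + (m : Cbar C))) (ℓ 0 * ℓ r) = 0 →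
    0 ≤ m ∧ ∃ k : ℕ, maxR i = minR i + (m : Cbar C) + (k : Cbar C)
  orbits_distinct : ∀ i i', i ≠ i' → ∀ m : ℤ, β i ≠ β i' + (m : Cbar C)
  orbits_cover : ∀ ξ : Cbar C, (Polynomial.aeval ξ) (ℓ 0 * ℓ r) = 0 →
    ∃ i, ∃ m : ℤ, ξ = β i + (m : Cbar C)
  conj_compat : ∀ (φ : Cbar C ≃ₐ[C] Cbar C) (i i' : Fin I), φ (maxR i) = maxR i' →
    β i - maxR i = β i' - maxR i'

/-- Membership in `Z = ⋃ᵢ {γ ∈ αᵢ + ℤ : α_{i,1} < γ ≤ βᵢ}`. -/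
def memZ {I : ℕ} (D : SuitableData C ℓ r I) (γ : Cbar C) : Prop :=
  ∃ i, (∃ m : ℕ, γ + (m : Cbar C) = D.β i) ∧ (∃ k : ℕ, 1 ≤ k ∧ γ = D.minR i + (k : Cbar C))

/-- `W` is a suitable basis of `A` at `{β₁, …, β_I}`. -/
def IsSuitableBasis {I : ℕ} (D : SuitableData C ℓ r I) (W : Fin r → (Fin r → RatFunc C)) :
    Prop :=
  IsVSBasis C r W ∧
    (∀ γ : Cbar C, memZ C ℓ r D γ → IsLocalIntegralBasis C ℓ r γ W) ∧
    (∀ γ : Cbar C, ¬ memZ C ℓ r D γ → localSpan C r γ W = localSpan C r γ (stdBasis C r))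

section

omit [CharZero C] [NeZero r]

/-- Taylor expansion at `α`: the ring homomorphism `p ↦ p(α + X)` into power series. -/
def psEval (α : Cbar C) : Polynomial C →+* PowerSeries (Cbar C) :=
  Polynomial.coeToPowerSeries.ringHom.comp
    ((Polynomial.compRingHom (X + Polynomial.C α)).comp
      (Polynomial.mapRingHom (algebraMap C (Cbar C))))

lemma psEval_injective (α : Cbar C) : Function.Injective (psEval C α) := by
  rw [injective_iff_map_eq_zero]
  intro p hp
  simp only [psEval, RingHom.comp_apply, Polynomial.coeToPowerSeries.ringHom_apply,
    Polynomial.coe_eq_zero_iff, Polynomial.coe_compRingHom_apply, coe_mapRingHom] at hp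
  rwa [Polynomial.comp_X_add_C_eq_zero_iff, Polynomial.map_eq_zero] at hp

lemma constantCoeff_psEval (α : Cbar C) (p : Polynomial C) :
    PowerSeries.constantCoeff (psEval C α p) = Polynomial.aeval α p := by
  simp only [psEval, RingHom.comp_apply, Polynomial.coeToPowerSeries.ringHom_apply,
    Polynomial.coe_compRingHom_apply, coe_mapRingHom, Polynomial.constantCoeff_coe]
  rw [Polynomial.coeff_zero_eq_eval_zero, Polynomial.eval_comp]
  simp [Polynomial.aeval_def, Polynomial.eval_map]

/-- The embedding `f ↦ f(α + q)` of rational functions into Laurent series. -/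
def ratEval (α : Cbar C) : RatFunc C →+* LS C :=
  IsFractionRing.lift (A := Polynomial C) (K := RatFunc C)
    (g := (HahnSeries.ofPowerSeries ℤ (Cbar C)).comp (psEval C α))
    (HahnSeries.ofPowerSeries_injective.comp (psEval_injective C α))

lemma ratEval_toRat (α : Cbar C) (p : Polynomial C) :
    ratEval C α (toRat C p) = HahnSeries.ofPowerSeries ℤ (Cbar C) (psEval C α p) :=
  IsFractionRing.lift_algebraMap _ p

lemma evalAt_eq_ratEval (α : Cbar C) (m : ℤ) (p : RatFunc C) :
    evalAt C α m p = ratEval C (α + m) p := by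
  have key : ∀ p : Polynomial C,
      Polynomial.eval₂ ((algebraMap (Cbar C) (LS C)).comp (algebraMap C (Cbar C)))
        (algebraMap (Cbar C) (LS C) α + (m : LS C) + qv C) p = ratEval C (α + m) (toRat C p) := by
    intro p
    rw [ratEval_toRat]
    refine congrArg (fun φ : Polynomial C →+* LS C => φ p) (a₁ := Polynomial.eval₂RingHom _ _)
      (a₂ := (HahnSeries.ofPowerSeries ℤ (Cbar C)).comp (psEval C (α + m))) ?_
    have hC : ∀ a : Cbar C, HahnSeries.ofPowerSeries ℤ (Cbar C) (PowerSeries.C a) =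
        algebraMap (Cbar C) (LS C) a := by
      intro a
      rw [HahnSeries.algebraMap_apply']
      rfl
    apply Polynomial.ringHom_ext
    · intro a
      simp [psEval, hC]
    · simp only [psEval, coe_eval₂RingHom, eval₂_X, RingHom.comp_apply,
        Polynomial.coeToPowerSeries.ringHom_apply, Polynomial.coe_compRingHom_apply,
        coe_mapRingHom, map_X, X_comp, Polynomial.coe_X, Polynomial.coe_C,
        map_add, hC, HahnSeries.ofPowerSeries_X, map_intCast]
      simp only [qv]
      ring
  rw [evalAt, RatFunc.eval, key, key, ← map_div₀]
  congr 1
  exact RatFunc.num_div_denom p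

lemma ratEval_ratσ (α : Cbar C) (p : RatFunc C) :
    ratEval C α (ratσ C p) = ratEval C (α + 1) p := by
  refine congrArg (fun φ : RatFunc C →+* LS C => φ p) (a₁ := (ratEval C α).comp (ratσ C)) ?_
  apply IsLocalization.ringHom_ext (nonZeroDivisors (Polynomial C))
  have hσ : ∀ p : Polynomial C, ratσ C (toRat C p) = toRat C (polyσ C p) := by
    intro p
    have := RatFunc.map_apply_div (polyσ C : Polynomial C →+* Polynomial C) (by
      intro p hp
      simp only [Submonoid.mem_comap]
      refine mem_nonZeroDivisors_iff_ne_zero.mpr ?_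
      have hp0 : p ≠ 0 := mem_nonZeroDivisors_iff_ne_zero.mp hp
      simpa using (map_ne_zero_iff _ (polyσ C).injective).mpr hp0) p 1
    simpa [ratσ, RatFunc.coe_mapRingHom_eq_coe_map] using this
  refine RingHom.ext fun p => ?_
  have h : psEval C α (polyσ C p) = psEval C (α + 1) p := by
    simp only [polyσ, polyShiftEquiv, psEval, RingHom.comp_apply,
      Polynomial.coeToPowerSeries.ringHom_apply, Polynomial.coe_compRingHom_apply,
      coe_mapRingHom, RingEquiv.coe_mk, Equiv.coe_fn_mk]
    rw [Polynomial.map_comp, Polynomial.comp_assoc]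
    simp [add_assoc]
  simp only [RingHom.comp_apply]
  rw [hσ, ratEval_toRat, ratEval_toRat, h]

lemma inLocalRing_of_ratEval (α : Cbar C) (f : RatFunc C) (h : PowerSeries (Cbar C))
    (hf : ratEval C α f = HahnSeries.ofPowerSeries ℤ (Cbar C) h) : InLocalRing C α f := by
  refine ⟨f.num, f.denom, ?_, (RatFunc.num_div_denom f).symm⟩
  intro h0
  have hd : toRat C f.denom ≠ 0 := by
    simpa using RatFunc.denom_ne_zero f
  have h1 : ratEval C α (toRat C f.num) = ratEval C α f * ratEval C α (toRat C f.denom) := by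
    rw [← map_mul]
    congr 1
    rw [eq_comm, ← eq_div_iff hd]
    exact (RatFunc.num_div_denom f).symm
  rw [hf, ratEval_toRat, ratEval_toRat, ← map_mul] at h1
  have h2 := congrArg PowerSeries.constantCoeff (HahnSeries.ofPowerSeries_injective h1)
  rw [map_mul, constantCoeff_psEval, constantCoeff_psEval, h0, mul_zero] at h2
  obtain ⟨u, v, huv⟩ := RatFunc.isCoprime_num_denom f
  have := congrArg (Polynomial.aeval α) huv
  simp [h0, h2] at this

lemma ratEval_mem_of_inLocalRing (α : Cbar C) (f : RatFunc C) (hf : InLocalRing C α f) :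
    ∃ h, ratEval C α f = HahnSeries.ofPowerSeries ℤ (Cbar C) h := by
  obtain ⟨p, q, hq, rfl⟩ := hf
  have hu : PowerSeries.constantCoeff (psEval C α q) ≠ 0 := by rwa [constantCoeff_psEval]
  refine ⟨psEval C α p * (psEval C α q)⁻¹, ?_⟩
  have h0 : HahnSeries.ofPowerSeries ℤ (Cbar C) (psEval C α q) ≠ 0 := by
    rw [map_ne_zero_iff _ HahnSeries.ofPowerSeries_injective]
    rintro h
    simp [h] at hu
  rw [map_div₀, ratEval_toRat, ratEval_toRat, div_eq_iff h0, ← map_mul, mul_assoc,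
    PowerSeries.inv_mul_cancel _ hu, mul_one]

lemma nonneg_nuq_iff (a : LS C) :
    0 ≤ nuq C a ↔ ∃ h, a = HahnSeries.ofPowerSeries ℤ (Cbar C) h := by
  constructor
  · intro h
    by_cases ha : a = 0
    · exact ⟨0, by simp [ha]⟩
    · rw [nuq, if_neg ha] at h
      have h' : (0 : ℤ) ≤ a.order := by exact_mod_cast h
      obtain ⟨n, hn⟩ := Int.eq_ofNat_of_zero_le h'
      exact ⟨_, (LaurentSeries.X_order_mul_powerSeriesPart hn.symm).symm⟩
  · rintro ⟨h, rfl⟩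
    unfold nuq
    split_ifs with h0
    · exact le_top
    · have : (0 : ℤ) ≤ (HahnSeries.ofPowerSeries ℤ (Cbar C) h).order := by
        by_contra! hlt
        have := HahnSeries.coeff_order_eq_zero.not.mpr h0
        rw [PowerSeries.coeff_coe, if_pos hlt] at this
        exact this rfl
      exact_mod_cast this

lemma exists_eq_X_mul_of_pos_nuq (a : LS C) (h : 0 < nuq C a) :
    ∃ h, a = HahnSeries.ofPowerSeries ℤ (Cbar C) (PowerSeries.X * h) := by
  by_cases ha : a = 0
  · exact ⟨0, by simp [ha]⟩
  · rw [nuq, if_neg ha] at h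
    have h' : (0 : ℤ) < a.order := by exact_mod_cast h
    obtain ⟨n, hn⟩ := Int.eq_ofNat_of_zero_le h'.le
    refine ⟨PowerSeries.X ^ (n - 1) * a.powerSeriesPart, ?_⟩
    rw [← mul_assoc, ← pow_succ', Nat.sub_add_cancel (by omega)]
    exact (LaurentSeries.X_order_mul_powerSeriesPart hn.symm).symm

/-- The local ring `C(x)_α` as a subring of `C(x)`. -/
def localSubring (α : Cbar C) : Subring (RatFunc C) :=
  (HahnSeries.ofPowerSeries ℤ (Cbar C)).range.comap (ratEval C α)

lemma mem_localSubring_iff (α : Cbar C) (f : RatFunc C) :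
    f ∈ localSubring C α ↔ InLocalRing C α f := by
  refine ⟨fun ⟨h, hh⟩ => inLocalRing_of_ratEval C α f h hh.symm, fun h => ?_⟩
  obtain ⟨g, hg⟩ := ratEval_mem_of_inLocalRing C α f h
  exact ⟨g, hg.symm⟩

lemma toRat_ne_zero {p : Polynomial C} (hp : p ≠ 0) : toRat C p ≠ 0 := by
  simpa using hp

/-- In a linear relation whose `k`-th coefficient is a unit at `β`, the `k`-th entry lies in
every power-series module containing the other entries. -/
lemma mem_of_relation (N : Submodule (PowerSeries (Cbar C)) (LS C)) (β : Cbar C)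
    (p : ℕ → Polynomial C) (x : ℕ → LS C) (k : ℕ) (hk : k ≤ r)
    (hrel : ∑ i ∈ Finset.range (r + 1), ratEval C β (toRat C (p i)) * x i = 0)
    (hpk : Polynomial.aeval β (p k) ≠ 0) (hx : ∀ i ≤ r, i ≠ k → x i ∈ N) : x k ∈ N := by
  have hk0 : ratEval C β (toRat C (p k)) ≠ 0 := by
    rw [_root_.map_ne_zero]
    apply toRat_ne_zero
    rintro h
    simp [h] at hpk
  have hkm : k ∈ Finset.range (r + 1) := Finset.mem_range.mpr (by omega)
  rw [← Finset.add_sum_erase _ _ hkm] at hrel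
  have hsum : x k = -∑ i ∈ (Finset.range (r + 1)).erase k,
      ratEval C β (toRat C (p i) / toRat C (p k)) * x i := by
    apply mul_left_cancel₀ hk0
    rw [eq_neg_of_add_eq_zero_left hrel, mul_neg, Finset.mul_sum]
    congr 1
    refine Finset.sum_congr rfl fun i _ => ?_
    rw [map_div₀]
    field_simp
  rw [hsum]
  refine N.neg_mem (N.sum_mem fun i hi => ?_)
  obtain ⟨hik, hir⟩ := Finset.mem_erase.mp hi
  obtain ⟨h, hh⟩ := ratEval_mem_of_inLocalRing C β _ ⟨p i, p k, hpk, rfl⟩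
  have := N.smul_mem h (hx i (by have := Finset.mem_range.mp hir; omega) hik)
  rwa [Algebra.smul_def, LaurentSeries.coe_algebraMap, ← hh] at this

lemma mem_solSet_iff (α : Cbar C) (b : ℤ → LS C) :
    b ∈ SolSet C ℓ r α ↔ ∀ n : ℤ, ∑ i ∈ Finset.range (r + 1),
      ratEval C (α + n) (toRat C (ℓ i)) * b (n + i) = 0 := by
  simp only [SolSet, Set.mem_ofPred_eq, evalAt_eq_ratEval]

lemma elemApply_zero (α : Cbar C) (f : Fin r → RatFunc C) (b : ℤ → LS C) :
    elemApply C r α f b 0 = ∑ i : Fin r, ratEval C α (f i) * b i := by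
  simp [elemApply, evalAt_eq_ratEval]

/-- To the left of all roots of `ℓ₀`, a solution stays in any power-series module containing its
initial values. -/
lemma mem_of_start_mem (N : Submodule (PowerSeries (Cbar C)) (LS C)) {α : Cbar C}
    {b : ℤ → LS C} (hb : b ∈ SolSet C ℓ r α)
    (hroot : ∀ n : ℤ, n < 0 → Polynomial.aeval (α + (n : Cbar C)) (ℓ 0) ≠ 0)
    (hstart : ∀ i : ℤ, 0 ≤ i → i < r → b i ∈ N) (n : ℕ) :
    ∀ i : ℤ, -(n : ℤ) ≤ i → i < r → b i ∈ N := by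
  induction n with
  | zero => simpa using hstart
  | succ n ih =>
    intro i hi hir
    by_cases hin : -(n : ℤ) ≤ i
    · exact ih i hin hir
    · have := mem_of_relation C r N (α + i) ℓ (fun j => b (i + j)) 0 (Nat.zero_le _)
        ((mem_solSet_iff C ℓ r α b).mp hb i) (hroot i (by omega))
        (fun j hj hj0 => ih _ (by push_cast at hi; omega) (by push_cast at hi; omega))
      simpa using this

/-- To the left of all roots of `ℓ_r`, a solution whose values far to the left lie in a
power-series module has its initial values in that module. -/
lemma mem_of_tail_mem (N : Submodule (PowerSeries (Cbar C)) (LS C)) {α : Cbar C}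
    {b : ℤ → LS C} (hb : b ∈ SolSet C ℓ r α)
    (hroot : ∀ n : ℤ, n < 0 → Polynomial.aeval (α + (n : Cbar C)) (ℓ r) ≠ 0)
    (n₀ : ℤ) (htail : ∀ i ≤ n₀, b i ∈ N) (k : ℕ) :
    ∀ i : ℤ, i ≤ n₀ + k → i < r → b i ∈ N := by
  induction k with
  | zero => intro i hi _; exact htail i (by simpa using hi)
  | succ k ih =>
    intro i hi hir
    by_cases hin : i ≤ n₀ + k
    · exact ih i hin hir
    · have := mem_of_relation C r N (α + (i - r : ℤ)) ℓ (fun j => b (i - r + j)) r le_rfl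
        ((mem_solSet_iff C ℓ r α b).mp hb (i - r)) (hroot (i - r) (by omega))
        (fun j hj hj0 => ih _ (by push_cast at hi; omega) (by push_cast at hi; omega))
      simpa using this

/-- The two-sided solution of the recurrence `∑ a i n * b (n + i) = 0` of order `r` with
prescribed values on `0, …, r - 1`. -/
def recSol {K : Type*} [Field K] (a : ℕ → ℤ → K) (start : ℤ → K) (n : ℤ) : K :=
  if n < 0 then
    -(∑ i : Fin r, a (i + 1) n * recSol a start (n + ((i : ℕ) + 1 : ℕ))) / a 0 n
  else if n < r then start n
  else -(∑ i : Fin r, a i (n - r) * recSol a start (n - r + (i : ℕ))) / a r (n - r)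
termination_by (if n < 0 then r - n else n).toNat
decreasing_by
  · have := i.isLt
    split_ifs <;> omega
  · have := i.isLt
    split_ifs <;> omega

lemma recSol_start {K : Type*} [Field K] (a : ℕ → ℤ → K) (start : ℤ → K) (n : ℤ)
    (h0 : 0 ≤ n) (hn : n < r) : recSol r a start n = start n := by
  rw [recSol, if_neg (by omega), if_pos hn]

lemma recSol_rec {K : Type*} [Field K] (a : ℕ → ℤ → K) (start : ℤ → K)
    (ha0 : ∀ n, a 0 n ≠ 0) (har : ∀ n, a r n ≠ 0) (n : ℤ) :
    ∑ i ∈ Finset.range (r + 1), a i n * recSol r a start (n + i) = 0 := by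
  by_cases hn : n < 0
  · have h := recSol.eq_def r a start n
    rw [if_pos hn, eq_div_iff (ha0 n)] at h
    rw [Finset.sum_range_succ', Finset.sum_range, Nat.cast_zero, add_zero, mul_comm (a 0 n), h]
    exact add_neg_cancel _
  · have h := recSol.eq_def r a start (n + r)
    rw [if_neg (by omega), if_neg (by omega), eq_div_iff (har _), add_sub_cancel_right] at h
    rw [Finset.sum_range_succ, Finset.sum_range, mul_comm (a r n), h]
    exact add_neg_cancel _

/-- At points weakly to the left of all roots of `ℓ₀ℓ_r` in their orbit, integral elements have
coefficients in the local ring. -/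
lemma inLocalRing_of_integralAt (hℓ : ℓ 0 * ℓ r ≠ 0) {α : Cbar C}
    (hroot : ∀ n : ℤ, n < 0 → Polynomial.aeval (α + (n : Cbar C)) (ℓ 0 * ℓ r) ≠ 0)
    (f : Fin r → RatFunc C) (hf : IntegralAt C ℓ r α f) (j : Fin r) :
    InLocalRing C α (f j) := by
  have hroot0 : ∀ n : ℤ, n < 0 → Polynomial.aeval (α + (n : Cbar C)) (ℓ 0) ≠ 0 := by
    intro n hn h
    exact hroot n hn (by rw [map_mul, h, zero_mul])
  have hrootr : ∀ n : ℤ, n < 0 → Polynomial.aeval (α + (n : Cbar C)) (ℓ r) ≠ 0 := by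
    intro n hn h
    exact hroot n hn (by rw [map_mul, h, mul_zero])
  set start : ℤ → LS C := fun n => if n = j then 1 else 0 with hstart
  set b : ℤ → LS C := recSol r (fun i n => ratEval C (α + n) (toRat C (ℓ i))) start
  have hbstart : ∀ i : ℤ, 0 ≤ i → i < r → b i = start i := fun i h0 hi =>
    recSol_start r _ start i h0 hi
  have hb : b ∈ SolSet C ℓ r α := by
    rw [mem_solSet_iff]
    refine recSol_rec r _ start (fun n => ?_) (fun n => ?_)
    · rw [_root_.map_ne_zero]
      exact toRat_ne_zero C (left_ne_zero_of_mul hℓ)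
    · rw [_root_.map_ne_zero]
      exact toRat_ne_zero C (right_ne_zero_of_mul hℓ)
  have hmem : ∀ (I : Ideal (PowerSeries (Cbar C))) (a : LS C),
      a ∈ Submodule.map (Algebra.linearMap (PowerSeries (Cbar C)) (LS C)) I ↔
        ∃ h ∈ I, HahnSeries.ofPowerSeries ℤ (Cbar C) h = a := by
    intro I a
    simp [Submodule.mem_map]
  set L := Filter.liminf (fun n : ℕ => nuq C (b (-(n : ℤ)))) Filter.atTop with hL
  have hL0 : 0 ≤ L := by
    refine Filter.le_liminf_of_le (by isBoundedDefault) (Filter.Eventually.of_forall fun n => ?_)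
    rw [nonneg_nuq_iff]
    have := mem_of_start_mem C ℓ r
      (Submodule.map (Algebra.linearMap (PowerSeries (Cbar C)) (LS C)) ⊤) hb hroot0
      (fun i h0 hi => by
        rw [hbstart i h0 hi, hmem, hstart]
        by_cases hij : i = j
        · exact ⟨1, trivial, by simp [hij]⟩
        · exact ⟨0, trivial, by simp [hij]⟩) n (-(n : ℤ)) le_rfl (by have := j.isLt; omega)
    obtain ⟨h, -, hh⟩ := (hmem _ _).mp this
    exact ⟨h, hh.symm⟩
  have hLtop : L ≠ ⊤ := by
    intro htop
    have hev : ∀ᶠ n : ℕ in Filter.atTop, 0 < nuq C (b (-(n : ℤ))) := by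
      refine Filter.eventually_lt_of_lt_liminf ?_ (by isBoundedDefault)
      rw [← hL, htop]
      exact EReal.zero_lt_top
    obtain ⟨m, hm⟩ := Filter.eventually_atTop.mp hev
    have := mem_of_tail_mem C ℓ r
      (Submodule.map (Algebra.linearMap (PowerSeries (Cbar C)) (LS C))
        (Ideal.span {PowerSeries.X})) hb hrootr (-(m : ℤ))
      (fun i hi => by
        obtain ⟨k, rfl⟩ : ∃ k : ℕ, i = -(k : ℤ) := ⟨(-i).toNat, by omega⟩
        obtain ⟨h, hh⟩ := exists_eq_X_mul_of_pos_nuq C _ (hm k (by omega))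
        exact (hmem _ _).mpr ⟨_, Ideal.mem_span_singleton.mpr (Dvd.intro _ rfl), hh.symm⟩)
      (m + r) (j : ℕ) (by have := j.isLt; push_cast; omega) (by have := j.isLt; omega)
    rw [hbstart _ (by omega) (by have := j.isLt; omega), hstart, hmem] at this
    obtain ⟨h, hI, hh⟩ := this
    obtain ⟨g, rfl⟩ := Ideal.mem_span_singleton.mp hI
    have h1 : PowerSeries.X * g = 1 :=
      HahnSeries.ofPowerSeries_injective (Γ := ℤ) (hh.trans (by simp))
    simpa using congrArg PowerSeries.constantCoeff h1
  have hval : ∀ b ∈ SolSet C ℓ r α, 0 ≤ esub (nuq C (elemApply C r α f b 0))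
      (Filter.liminf (fun n : ℕ => nuq C (b (-(n : ℤ)))) Filter.atTop) := le_iInf₂_iff.mp hf
  have hfb := hval b hb
  rw [← hL, esub, if_neg hLtop] at hfb
  have hfj : 0 ≤ nuq C (elemApply C r α f b 0) :=
    hfb.trans ((EReal.sub_le_sub le_rfl hL0).trans (by simp))
  have helem : elemApply C r α f b 0 = ratEval C α (f j) := by
    rw [elemApply_zero, Finset.sum_eq_single j]
    · rw [hbstart _ (by omega) (by have := j.isLt; omega), hstart]
      simp
    · intro i _ hij
      rw [hbstart _ (by omega) (by have := i.isLt; omega), hstart]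
      have : ((i : ℕ) : ℤ) ≠ ((j : ℕ) : ℤ) := by
        exact_mod_cast Fin.val_ne_of_ne hij
      simp [this]
    · simp
  rw [helem, nonneg_nuq_iff] at hfj
  obtain ⟨h, hh⟩ := hfj
  exact inLocalRing_of_ratEval C α _ h hh

lemma shift_mem_solSet {α : Cbar C} {b : ℤ → LS C} (hb : b ∈ SolSet C ℓ r α) :
    (fun n => b (n + 1)) ∈ SolSet C ℓ r (α + 1) := by
  rw [mem_solSet_iff] at hb ⊢
  intro n
  have := hb (n + 1)
  convert this using 3 with i
  · push_cast
    rw [add_assoc, add_comm (1 : Cbar C)]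
  · rw [add_right_comm]

lemma elemApply_Smap [NeZero r] (hℓr : ℓ r ≠ 0) {α : Cbar C} {b : ℤ → LS C}
    (hb : b ∈ SolSet C ℓ r α) (f : Fin r → RatFunc C) :
    elemApply C r α (Smap C ℓ r f) b 0 = elemApply C r (α + 1) f (fun n => b (n + 1)) 0 := by
  have hrel := (mem_solSet_iff C ℓ r α b).mp hb 0
  have h0 : ratEval C α (toRat C (ℓ r)) ≠ 0 := by
    rw [_root_.map_ne_zero]
    exact toRat_ne_zero C hℓr
  rw [elemApply_zero, elemApply_zero]
  obtain ⟨s, rfl⟩ : ∃ s, r = s + 1 := Nat.exists_eq_succ_of_ne_zero (NeZero.ne r)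
  have hlast : lastIdx (s + 1) = Fin.last s := rfl
  rw [Finset.sum_range_succ, Finset.sum_range] at hrel
  simp only [Int.cast_zero, add_zero, zero_add] at hrel
  have hlastterm : ∑ i : Fin (s + 1),
      ratEval C α (toRat C (ℓ i) / toRat C (ℓ (s + 1))) * b i = -b (s + 1 : ℕ) := by
    apply mul_left_cancel₀ h0
    rw [mul_neg, ← eq_neg_of_add_eq_zero_left hrel, Finset.mul_sum]
    refine Finset.sum_congr rfl fun i _ => ?_
    rw [map_div₀]
    field_simp
  simp only [Smap, map_sub, map_mul, ratEval_ratσ, hlast, sub_mul, Finset.sum_sub_distrib,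
    mul_assoc]
  rw [← Finset.mul_sum, hlastterm, Fin.sum_univ_succ, Fin.sum_univ_castSucc]
  simp [ratEval_ratσ]
  rfl

lemma integralAt_Smap [NeZero r] (hℓr : ℓ r ≠ 0) {α : Cbar C} {f : Fin r → RatFunc C}
    (hf : IntegralAt C ℓ r (α + 1) f) : IntegralAt C ℓ r α (Smap C ℓ r f) := by
  refine le_iInf₂ fun b hb => ?_
  have h : ∀ b ∈ SolSet C ℓ r (α + 1), 0 ≤ esub (nuq C (elemApply C r (α + 1) f b 0))
      (Filter.liminf (fun n : ℕ => nuq C (b (-(n : ℤ)))) Filter.atTop) := le_iInf₂_iff.mp hf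
  have h1 := h _ (shift_mem_solSet C ℓ r hb)
  rw [← elemApply_Smap C ℓ r hℓr hb, ← Filter.liminf_nat_add _ 1] at h1
  simpa using h1

lemma ratσ_mem_localSubring {α : Cbar C} {f : RatFunc C} (hf : f ∈ localSubring C (α + 1)) :
    ratσ C f ∈ localSubring C α := by
  simpa [localSubring, ratEval_ratσ] using hf

lemma mem_localSpan_stdBasis_iff (α : Cbar C) (f : Fin r → RatFunc C) :
    f ∈ localSpan C r α (stdBasis C r) ↔ ∀ j, InLocalRing C α (f j) := by
  have key : ∀ c : Fin r → RatFunc C, ∑ i, c i • stdBasis C r i = c := by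
    intro c
    ext j
    simp [stdBasis, Finset.sum_apply]
  constructor
  · rintro ⟨c, hc, rfl⟩
    rwa [key]
  · exact fun h => ⟨f, h, (key f).symm⟩

lemma self_mem_localSpan (α : Cbar C) (W : Fin r → (Fin r → RatFunc C)) (i : Fin r) :
    W i ∈ localSpan C r α W := by
  refine ⟨fun j => if j = i then 1 else 0, fun j => ?_, by simp⟩
  rw [← mem_localSubring_iff]
  dsimp only
  split_ifs
  · exact one_mem _
  · exact zero_mem _

/-- `S` preserves coefficients in the local rings away from the roots of `ℓ_r`. -/
lemma Smap_mem_localRing [NeZero r] {α : Cbar C} (hα : Polynomial.aeval α (ℓ r) ≠ 0)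
    {f : Fin r → RatFunc C} (hf : ∀ j, InLocalRing C (α + 1) (f j)) (j : Fin r) :
    InLocalRing C α (Smap C ℓ r f j) := by
  simp only [← mem_localSubring_iff] at hf ⊢
  have hlast : toRat C (ℓ j) / toRat C (ℓ r) ∈ localSubring C α :=
    (mem_localSubring_iff C α _).mpr ⟨_, _, hα, rfl⟩
  unfold Smap
  refine sub_mem ?_ (mul_mem (ratσ_mem_localSubring C (hf _)) hlast)
  split_ifs
  · exact zero_mem _
  · exact ratσ_mem_localSubring C (hf _)

variable {C ℓ r} in
/-- Away from the points `β i`, `S` maps a suitable basis into its own local span. -/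
lemma IsSuitableBasis.Smap_mem_localSpan [NeZero r] (hℓ : ℓ 0 * ℓ r ≠ 0) {I : ℕ}
    {D : SuitableData C ℓ r I} {W : Fin r → (Fin r → RatFunc C)}
    (hW : IsSuitableBasis C ℓ r D W) {α : Cbar C} (hα : ∀ i, α ≠ D.β i) (j : Fin r) :
    Smap C ℓ r (W j) ∈ localSpan C r α W := by
  obtain ⟨-, hZ, hnZ⟩ := hW
  by_cases h1 : memZ C ℓ r D (α + 1)
  · have hint := integralAt_Smap C ℓ r (right_ne_zero_of_mul hℓ) ((hZ _ h1).2.1 j)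
    by_cases h0 : memZ C ℓ r D α
    · exact (hZ _ h0).2.2 _ hint
    · obtain ⟨i, ⟨m, hm⟩, k, hk1, hk⟩ := h1
      obtain ⟨k, rfl⟩ : ∃ k', k = k' + 1 := ⟨k - 1, by omega⟩
      have hαk : α = D.minR i + (k : Cbar C) := by
        push_cast at hk
        linear_combination hk
      have hk0 : k = 0 := by
        by_contra hk0
        refine h0 ⟨i, ⟨m + 1, ?_⟩, k, by omega, hαk⟩
        push_cast
        linear_combination hm
      have hmin : α = D.minR i := by simpa [hk0] using hαk
      rw [hnZ _ h0, mem_localSpan_stdBasis_iff]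
      refine inLocalRing_of_integralAt C ℓ r hℓ (fun n hn h => ?_) _ hint
      rw [hmin] at h
      have := (D.roots_between i n h).1
      omega
  · have h0 : ¬ memZ C ℓ r D α := by
      rintro ⟨i, ⟨m, hm⟩, k, hk1, hk⟩
      obtain _ | m := m
      · exact hα i (by simpa using hm)
      · refine h1 ⟨i, ⟨m, ?_⟩, k + 1, by omega, ?_⟩
        · rw [← hm]
          push_cast
          ring
        · rw [hk]
          push_cast
          ring
    have hr0 : Polynomial.aeval α (ℓ r) ≠ 0 := by
      intro hroot
      have hroot' : Polynomial.aeval α (ℓ 0 * ℓ r) = 0 := by rw [map_mul, hroot, mul_zero]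
      obtain ⟨i, m, hm⟩ := D.orbits_cover α hroot'
      obtain ⟨m₁, hm₁⟩ := D.maxR_le_β i
      obtain ⟨m₂, hm₂⟩ := D.minR_le_maxR i
      have hαn : α = D.minR i + ((m + m₁ + m₂ : ℤ) : Cbar C) := by
        rw [hm, hm₁, hm₂]
        push_cast
        ring
      obtain ⟨hn, k, hk⟩ := D.roots_between i (m + m₁ + m₂) (by rwa [← hαn])
      rw [← hαn] at hk
      have hβ : D.β i = α + ((k + m₁ : ℕ) : Cbar C) := by
        rw [hm₁, hk]
        push_cast
        ring
      obtain hz | ⟨t, ht⟩ : k + m₁ = 0 ∨ ∃ t, k + m₁ = t + 1 := by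
        cases k + m₁ <;> simp
      · exact hα i (by rw [hβ, hz]; simp)
      · obtain ⟨n, hn'⟩ := Int.eq_ofNat_of_zero_le hn
        refine h1 ⟨i, ⟨t, ?_⟩, n + 1, by omega, ?_⟩
        · rw [hβ, ht]
          push_cast
          ring
        · rw [hαn, hn']
          push_cast
          ring
    rw [hnZ _ h0, mem_localSpan_stdBasis_iff]
    refine Smap_mem_localRing C ℓ r hr0 ?_
    rw [← mem_localSpan_stdBasis_iff, ← hnZ _ h1]
    exact self_mem_localSpan C r _ W j

lemma minpoly_dvd_of_inLocalRing {α : Cbar C} {p e : Polynomial C} (he : e ≠ 0)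
    (hα : Polynomial.aeval α e = 0) (h : InLocalRing C α (toRat C p / toRat C e)) :
    minpoly C α ∣ p := by
  obtain ⟨a, b, hb, hab⟩ := h
  have hb0 : b ≠ 0 := by
    rintro rfl
    simp at hb
  rw [div_eq_div_iff (toRat_ne_zero C he) (toRat_ne_zero C hb0), ← map_mul, ← map_mul] at hab
  have hpb : p * b = a * e := IsFractionRing.injective _ (RatFunc C) hab
  apply minpoly.dvd
  have := congrArg (Polynomial.aeval α) hpb
  simp only [map_mul, hα, mul_zero, mul_eq_zero] at this
  exact this.resolve_right hb

/-- The matrix of `S` with respect to `1, S, …, S^{r-1}`. -/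
def companion : Matrix (Fin r) (Fin r) (RatFunc C) :=
  Matrix.of fun i => Smap C ℓ r (stdBasis C r i)

lemma Smap_apply_eq [NeZero r] (f : Fin r → RatFunc C) (j : Fin r) :
    Smap C ℓ r f j = ∑ i, ratσ C (f i) * companion C ℓ r i j := by
  simp only [companion, Matrix.of_apply, Smap, stdBasis, mul_sub, Finset.sum_sub_distrib]
  congr 1
  · split_ifs with h
    · simp
    · simp [apply_ite (ratσ C)]
  · simp [apply_ite (ratσ C)]

lemma isUnit_companion [NeZero r] (hℓ : ℓ 0 * ℓ r ≠ 0) : IsUnit (companion C ℓ r) := by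
  rw [← Matrix.vecMul_injective_iff_isUnit]
  rw [← Matrix.coe_vecMulLinear, injective_iff_map_eq_zero]
  intro c hc
  replace hc : Matrix.vecMul c (companion C ℓ r) = 0 := hc
  have hcoord : ∀ j : Fin r, (if (j : ℕ) = 0 then 0 else
      c ⟨(j : ℕ) - 1, lt_of_le_of_lt (Nat.sub_le _ _) j.isLt⟩)
        - c (lastIdx r) * (toRat C (ℓ j) / toRat C (ℓ r)) = 0 := by
    intro j
    refine Eq.trans ?_ (congrFun hc j)
    simp only [Matrix.vecMul, dotProduct, companion, Matrix.of_apply, Smap, stdBasis, mul_sub,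
      Finset.sum_sub_distrib]
    congr 1
    · split_ifs with h
      · simp
      · simp [apply_ite (ratσ C)]
    · simp [apply_ite (ratσ C)]
  have hlast : c (lastIdx r) = 0 := by
    have := hcoord ⟨0, NeZero.pos r⟩
    rw [if_pos rfl, zero_sub, neg_eq_zero, mul_eq_zero] at this
    exact this.resolve_right (div_ne_zero (toRat_ne_zero C (left_ne_zero_of_mul hℓ))
      (toRat_ne_zero C (right_ne_zero_of_mul hℓ)))
  ext i
  by_cases hi : (i : ℕ) + 1 < r
  · have := hcoord ⟨i + 1, hi⟩
    simpa [hlast] using this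
  · have : i = lastIdx r := Fin.ext (by simp only [lastIdx]; omega)
    rw [this, hlast]
    rfl

/-- The matrix of `S` with respect to any basis is invertible. -/
lemma isUnit_of_Smap_eq [NeZero r] (hℓ : ℓ 0 * ℓ r ≠ 0) {W : Fin r → (Fin r → RatFunc C)}
    (hW : LinearIndependent (RatFunc C) W) (N : Matrix (Fin r) (Fin r) (RatFunc C))
    (hN : ∀ i, Smap C ℓ r (W i) = ∑ j, N i j • W j) : IsUnit N := by
  set T : Matrix (Fin r) (Fin r) (RatFunc C) := Matrix.of W with hT
  have hTu : IsUnit T := Matrix.linearIndependent_rows_iff_isUnit.mp hW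
  have hmul : N * T = (ratσ C).mapMatrix T * companion C ℓ r := by
    ext i j
    have := congrFun (hN i) j
    rw [Smap_apply_eq] at this
    simpa [Matrix.mul_apply, hT, Finset.sum_apply] using this.symm
  have : IsUnit (N * T) := by
    rw [hmul]
    exact (hTu.map _).mul (isUnit_companion C ℓ r hℓ)
  rw [Matrix.isUnit_iff_isUnit_det, Matrix.det_mul] at this
  exact (Matrix.isUnit_iff_isUnit_det _).mpr (isUnit_of_mul_isUnit_left this)

variable {C r} in
lemma coeff_inLocalRing_of_mem_localSpan {α : Cbar C} {W : Fin r → (Fin r → RatFunc C)}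
    (hW : LinearIndependent (RatFunc C) W) {c : Fin r → RatFunc C}
    (h : ∑ j, c j • W j ∈ localSpan C r α W) (j : Fin r) : InLocalRing C α (c j) := by
  obtain ⟨d, hd, hcd⟩ := h
  have h0 : ∑ j, (c j - d j) • W j = 0 := by
    simp only [sub_smul, Finset.sum_sub_distrib, hcd, sub_self]
  have := Fintype.linearIndependent_iff.mp hW _ h0 j
  rw [sub_eq_zero.mp this]
  exact hd j

end

/-- A polynomial is shift-free if no two of its roots differ by a nonzero integer. -/
lemma shiftFree_of_roots {p : Polynomial C} (h : ∀ (ξ : Cbar C) (k : ℤ),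
    Polynomial.aeval ξ p = 0 → Polynomial.aeval (ξ + (k : Cbar C)) p = 0 → k = 0) :
    ShiftFree p := by
  intro k hk
  rw [Polynomial.isCoprime_iff_aeval_ne_zero_of_isAlgClosed C (Cbar C)]
  intro ξ
  by_contra! hξ
  refine hk (h ξ k hξ.1 ?_)
  simpa [Polynomial.aeval_comp] using hξ.2

theorem statement9 [NeZero r] (hr : 1 ≤ r) (hℓ : ℓ 0 * ℓ r ≠ 0) {I : ℕ}
    (D : SuitableData C ℓ r I) (W : Fin r → (Fin r → RatFunc C))
    (hW : IsSuitableBasis C ℓ r D W)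
    (e : Polynomial C) (M : Matrix (Fin r) (Fin r) (Polynomial C)) (he : e ≠ 0)
    (hSW : ∀ i, Smap C ℓ r (W i) = ∑ j, (toRat C (M i j) / toRat C e) • W j)
    (hgcd : ∀ d : Polynomial C, d ∣ e → (∀ i j, d ∣ M i j) → IsUnit d) :
    ShiftFree e ∧ (∀ ξ : Cbar C, (Polynomial.aeval ξ) e = 0 → ∃ i, ξ = D.β i) ∧
      IsUnit (M.map (toRat C)) := by
  have hroots : ∀ ξ : Cbar C, (Polynomial.aeval ξ) e = 0 → ∃ i, ξ = D.β i := by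
    intro ξ hξ
    by_contra! hβ
    refine minpoly.not_isUnit C ξ (hgcd _ (minpoly.dvd _ _ hξ) fun i j => ?_)
    refine minpoly_dvd_of_inLocalRing C he hξ ?_
    have hmem := hW.Smap_mem_localSpan hℓ hβ i
    rw [hSW i] at hmem
    exact coeff_inLocalRing_of_mem_localSpan hW.1.1 hmem j
  refine ⟨shiftFree_of_roots C fun ξ k h0 hk => ?_, hroots, ?_⟩
  · obtain ⟨i, hi⟩ := hroots _ h0
    obtain ⟨i', hi'⟩ := hroots _ hk
    rw [hi] at hi'
    obtain rfl | hne := eq_or_ne i' i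
    · simpa using hi'
    · exact absurd hi'.symm (D.orbits_distinct i' i hne k)
  · have hunit := isUnit_of_Smap_eq C ℓ r hℓ hW.1.1
      (Matrix.of fun i j => toRat C (M i j) / toRat C e) hSW
    have he' : IsUnit (toRat C e) := (toRat_ne_zero C he).isUnit
    have hM : M.map (toRat C) = he'.unit • Matrix.of fun i j => toRat C (M i j) / toRat C e := by
      ext i j
      simp [Units.smul_def, mul_div_cancel₀ _ he'.ne_zero]
    rw [hM]
    exact hunit.smul _

end PRec
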